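/- Let (X,T) be a transitive topological dynamical system. Then (X,T) is disjoint from every minimal topological dynamical system if and only if (X,T) is weakly mixing and there exists a countable dense subset D of X such that for every minimal t.d.s. (Y,S), every point y ∈ Y, every open neighbourhood V of y, and every nonempty open set U ⊆ X, there is a point x ∈ D ∩ U for which the set N_{T×S}((x,y), U×V) = {n ∈ ℤ₊ : T^n x ∈ U and S^n y ∈ V} is syndetic. -/

import Mathlib

open Set Function Filter Topology

structure TDS where
  carrier : Type
  [ms : MetricSpace carrier]
  [cs : CompactSpace carrier]
  map : carrier → carrier
  cont : Continuous map
  surj : Function.Surjective map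

attribute [instance] TDS.ms TDS.cs

def orbit {X : Type*} (T : X → X) (x : X) : Set X :=
  Set.range fun n : ℕ => T^[n] x

def IsMinimalSys {Y : Type*} [TopologicalSpace Y] (S : Y → Y) : Prop :=
  ∀ y : Y, Dense (orbit S y)

def IsTransitiveSys {X : Type*} [TopologicalSpace X] (T : X → X) : Prop :=
  ∀ U V : Set X, IsOpen U → IsOpen V → U.Nonempty → V.Nonempty →
    {n : ℕ | (U ∩ T^[n] ⁻¹' V).Nonempty}.Infinite

def IsWeaklyMixingSys {X : Type*} [TopologicalSpace X] (T : X → X) : Prop :=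
  IsTransitiveSys fun p : X × X => (T p.1, T p.2)

def IsJoining {X Y : Type*} [TopologicalSpace X] [TopologicalSpace Y]
    (T : X → X) (S : Y → Y) (J : Set (X × Y)) : Prop :=
  J.Nonempty ∧ IsClosed J ∧ (∀ p ∈ J, (T p.1, S p.2) ∈ J) ∧
    Prod.fst '' J = Set.univ ∧ Prod.snd '' J = Set.univ

def DisjointSys {X Y : Type*} [TopologicalSpace X] [TopologicalSpace Y]
    (T : X → X) (S : Y → Y) : Prop :=
  ∀ J : Set (X × Y), IsJoining T S J → J = Set.univ

def Syndetic (A : Set ℕ) : Prop :=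
  ∃ N : ℕ, ∀ i : ℕ, ∃ j ≤ N, i + j ∈ A

def Thick (A : Set ℕ) : Prop :=
  ∀ L : ℕ, ∃ n : ℕ, ∀ j ≤ L, n + j ∈ A

def IsMinimalPoint {X : Type*} [TopologicalSpace X] (T : X → X) (x : X) : Prop :=
  ∀ y ∈ closure (orbit T x), closure (orbit T x) ⊆ closure (orbit T y)

def Proximal {X : Type*} [MetricSpace X] (T : X → X) (x y : X) : Prop :=
  ∃ u : ℕ → ℕ, Filter.Tendsto (fun i => dist (T^[u i] x) (T^[u i] y)) Filter.atTop (nhds 0)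

def IsDistalPoint {X : Type*} [MetricSpace X] (T : X → X) (x : X) : Prop :=
  ∀ y ∈ closure (orbit T x), Proximal T x y → y = x

def DynSyndetic (B : Set ℕ) : Prop :=
  ∃ 𝒴 : TDS, IsMinimalSys 𝒴.map ∧
    ∃ (y : 𝒴.carrier) (V : Set 𝒴.carrier),
      IsOpen V ∧ y ∈ V ∧ {n : ℕ | 𝒴.map^[n] y ∈ V} ⊆ B

def CentralSet (S : Set ℕ) : Prop :=
  ∃ 𝒵 : TDS, ∃ (z w : 𝒵.carrier) (W : Set 𝒵.carrier),
    IsMinimalPoint 𝒵.map w ∧ Proximal 𝒵.map z w ∧ IsOpen W ∧ w ∈ W ∧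
    {n : ℕ | 𝒵.map^[n] z ∈ W} ⊆ S

def CStarSet (A : Set ℕ) : Prop :=
  ∀ S : Set ℕ, CentralSet S → (A ∩ S).Nonempty

section Dynamics

variable {Z : Type*}

lemma orbit_subset_of_mapsTo {S : Z → Z} {C : Set Z} (hC : MapsTo S C C) {z : Z} (hz : z ∈ C) :
    orbit S z ⊆ C := by
  rintro _ ⟨n, rfl⟩
  exact hC.iterate n hz

lemma self_mem_orbit (S : Z → Z) (z : Z) : z ∈ orbit S z := ⟨0, rfl⟩

lemma iterate_prodMap_apply {Y : Type*} (T : Z → Z) (S : Y → Y) (n : ℕ) (p : Z × Y) :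
    (fun q : Z × Y => (T q.1, S q.2))^[n] p = (T^[n] p.1, S^[n] p.2) := by
  induction n generalizing p with
  | zero => rfl
  | succ n ih => simp [iterate_succ_apply, ih]

variable [TopologicalSpace Z]

lemma mapsTo_closure_orbit {S : Z → Z} (hS : Continuous S) (z : Z) :
    MapsTo S (closure (orbit S z)) (closure (orbit S z)) := by
  refine MapsTo.closure ?_ hS
  rintro _ ⟨n, rfl⟩
  exact ⟨n + 1, iterate_succ_apply' S n z⟩

/-- A nonempty closed invariant set in which every orbit is dense. -/
structure IsMinimalSubset (S : Z → Z) (M : Set Z) : Prop where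
  isClosed : IsClosed M
  nonempty : M.Nonempty
  mapsTo : MapsTo S M M
  subset_closure_orbit : ∀ z ∈ M, M ⊆ closure (orbit S z)

lemma exists_isMinimalSubset [CompactSpace Z] {S : Z → Z} (hS : Continuous S) {C : Set Z}
    (hC : IsClosed C) (hne : C.Nonempty) (hinv : MapsTo S C C) :
    ∃ M ⊆ C, IsMinimalSubset S M := by
  obtain ⟨M, hMC, hM⟩ := zorn_superset_nonempty
    {K : Set Z | IsClosed K ∧ K.Nonempty ∧ MapsTo S K K}
    (fun c hc hchain hcne => by
      refine ⟨⋂₀ c, ⟨isClosed_sInter fun K hK => (hc hK).1, ?_, ?_⟩,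
        fun K hK => sInter_subset_of_mem hK⟩
      · have := hcne.to_subtype
        exact IsCompact.nonempty_sInter_of_directed_nonempty_isCompact_isClosed
          (fun K hK L hL => (hchain.total hK hL).elim (fun h => ⟨K, hK, subset_rfl, h⟩)
            fun h => ⟨L, hL, h, subset_rfl⟩) (fun K hK => (hc hK).2.1)
          (fun K hK => (hc hK).1.isCompact) (fun K hK => (hc hK).1)
      · intro z hz K hK
        exact (hc hK).2.2 (hz K hK)) C ⟨hC, hne, hinv⟩
  refine ⟨M, hMC, hM.prop.1, hM.prop.2.1, hM.prop.2.2, fun z hz => ?_⟩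
  refine hM.le_of_le ⟨isClosed_closure, ⟨z, subset_closure (self_mem_orbit S z)⟩,
    mapsTo_closure_orbit hS z⟩ ?_
  exact closure_minimal (orbit_subset_of_mapsTo hM.prop.2.2 hz) hM.prop.1

lemma IsMinimalSubset.exists_iterate_mem {S : Z → Z} {M : Set Z} (hM : IsMinimalSubset S M)
    {W : Set Z} (hW : IsOpen W) (hMW : (M ∩ W).Nonempty) {z : Z} (hz : z ∈ M) :
    ∃ n, S^[n] z ∈ W := by
  obtain ⟨w, hwM, hwW⟩ := hMW
  obtain ⟨_, h, n, rfl⟩ := mem_closure_iff.1 (hM.subset_closure_orbit z hz hwM) W hW hwW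
  exact ⟨n, h⟩

lemma IsMinimalSubset.syndetic [CompactSpace Z] {S : Z → Z} (hS : Continuous S) {M : Set Z}
    (hM : IsMinimalSubset S M) {W : Set Z} (hW : IsOpen W) (hMW : (M ∩ W).Nonempty) {z : Z}
    (hz : z ∈ M) : Syndetic {n | S^[n] z ∈ W} := by
  obtain ⟨F, hF⟩ := hM.isClosed.isCompact.elim_finite_subcover (fun n : ℕ => S^[n] ⁻¹' W)
    (fun n => hW.preimage (hS.iterate n))
    (fun w hw => mem_iUnion.2 (hM.exists_iterate_mem hW hMW hw))
  refine ⟨F.sup id, fun i => ?_⟩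
  obtain ⟨j, hj, hjW⟩ := mem_iUnion₂.1 (hF (hM.mapsTo.iterate i hz))
  refine ⟨j, Finset.le_sup (f := id) hj, ?_⟩
  rw [mem_ofPred_eq, add_comm, iterate_add_apply]
  exact hjW

lemma image_closure_orbit_eq_univ [CompactSpace Z] {W : Type*} [TopologicalSpace W] [T2Space W]
    {R : Z → Z} {Q : W → W} {f : Z → W} {z : Z} {w : W} (hf : Continuous f)
    (hw : Dense (orbit Q w)) (h : ∀ n, f (R^[n] z) = Q^[n] w) :
    f '' closure (orbit R z) = univ := by
  refine eq_univ_of_univ_subset ?_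
  rw [← hw.closure_eq]
  refine closure_minimal ?_ (isClosed_closure.isCompact.image hf).isClosed
  rintro _ ⟨n, rfl⟩
  exact ⟨_, subset_closure ⟨n, rfl⟩, h n⟩

end Dynamics

lemma IsMinimalSubset.exists_tds {Z : Type} [TopologicalSpace Z] [CompactSpace Z]
    [TopologicalSpace.MetrizableSpace Z] {S : Z → Z} (hS : Continuous S) {M : Set Z}
    (hM : IsMinimalSubset S M) :
    ∃ 𝒴 : TDS, IsMinimalSys 𝒴.map ∧ ∃ φ : 𝒴.carrier → Z, Continuous φ ∧ range φ = M ∧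
      ∀ n y, φ (𝒴.map^[n] y) = S^[n] (φ y) := by
  let _ : MetricSpace Z := TopologicalSpace.metrizableSpaceMetric Z
  have : CompactSpace M := isCompact_iff_compactSpace.1 hM.isClosed.isCompact
  let R : M → M := hM.mapsTo.restrict
  have hR : Continuous R := hS.restrict hM.mapsTo
  have hsemi : ∀ n (y : M), ((R^[n] y : M) : Z) = S^[n] y := fun n y => by
    induction n with
    | zero => rfl
    | succ n ih => rw [iterate_succ_apply', iterate_succ_apply', ← ih]; rfl
  have hmin : IsMinimalSys R := by
    intro y
    rw [Subtype.dense_iff]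
    have : Subtype.val '' orbit R y = orbit S (y : Z) := by
      ext w
      simp [orbit, hsemi]
    rw [this]
    exact hM.subset_closure_orbit y y.2
  have hsurj : Surjective R := by
    intro w
    have hcl : IsClosed (range R) := (isCompact_range hR).isClosed
    have hsub : orbit R (R w) ⊆ range R := by
      rintro _ ⟨n, rfl⟩
      exact ⟨R^[n] w, by rw [← iterate_succ_apply' R, iterate_succ_apply]⟩
    exact closure_minimal hsub hcl (hmin (R w) w)
  exact ⟨⟨M, R, hR, hsurj⟩, hmin, Subtype.val, continuous_subtype_val, Subtype.range_val, hsemi⟩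

section Disjointness

variable {X : Type*} [MetricSpace X] [CompactSpace X] {T : X → X}

lemma IsTransitiveSys.exists_dense_orbit (hT : IsTransitiveSys T) (hTc : Continuous T) {U : Set X}
    (hU : IsOpen U) (hne : U.Nonempty) : ∃ x ∈ U, Dense (orbit T x) := by
  have hd : Dense (⋂ V ∈ TopologicalSpace.countableBasis X, ⋃ n : ℕ, T^[n] ⁻¹' V) := by
    refine dense_biInter_of_isOpen (fun V hV => isOpen_iUnion fun n =>
      (TopologicalSpace.isOpen_of_mem_countableBasis hV).preimage (hTc.iterate n))
      (TopologicalSpace.countable_countableBasis X) fun V hV => ?_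
    rw [dense_iff_inter_open]
    intro W hW hWne
    obtain ⟨n, x, hxW, hxV⟩ := (hT W V hW (TopologicalSpace.isOpen_of_mem_countableBasis hV) hWne
      (TopologicalSpace.nonempty_of_mem_countableBasis hV)).nonempty
    exact ⟨x, hxW, mem_iUnion.2 ⟨n, hxV⟩⟩
  obtain ⟨x, hxU, hx⟩ := hd.inter_open_nonempty U hU hne
  refine ⟨x, hxU, (TopologicalSpace.isBasis_countableBasis X).dense_iff.2 fun V hV _ => ?_⟩
  obtain ⟨n, hn⟩ := mem_iUnion.1 (mem_iInter₂.1 hx V hV)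
  exact ⟨_, hn, n, rfl⟩

variable {Y : Type*} [MetricSpace Y] [CompactSpace Y] {S : Y → Y}

lemma DisjointSys.exists_iterate_mem (hd : DisjointSys T S) (hTc : Continuous T)
    (hSc : Continuous S) {x : X} {y : Y} (hx : Dense (orbit T x)) (hy : Dense (orbit S y))
    {U : Set X} {V : Set Y} (hU : IsOpen U) (hV : IsOpen V) (hUne : U.Nonempty)
    (hVne : V.Nonempty) : ∃ n, T^[n] x ∈ U ∧ S^[n] y ∈ V := by
  let R : X × Y → X × Y := fun q => (T q.1, S q.2)
  have hR : Continuous R := by fun_prop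
  have hJ := hd (closure (orbit R (x, y))) ⟨⟨_, subset_closure (self_mem_orbit R _)⟩,
    isClosed_closure, mapsTo_closure_orbit hR _,
    image_closure_orbit_eq_univ continuous_fst hx fun n => by rw [iterate_prodMap_apply],
    image_closure_orbit_eq_univ continuous_snd hy fun n => by rw [iterate_prodMap_apply]⟩
  obtain ⟨u, hu⟩ := hUne
  obtain ⟨v, hv⟩ := hVne
  obtain ⟨_, hm, n, rfl⟩ := mem_closure_iff.1 (hJ ▸ mem_univ (u, v) :
    (u, v) ∈ closure (orbit R (x, y))) (U ×ˢ V) (hU.prod hV) ⟨hu, hv⟩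
  simp only [R, iterate_prodMap_apply] at hm
  exact ⟨n, hm⟩

lemma DisjointSys.exists_open_finset (hd : DisjointSys T S) (hTc : Continuous T)
    (hSc : Continuous S) (hT : IsTransitiveSys T) (hS : IsMinimalSys S)
    {U₀ U : Set X} {V : Set Y} (hU₀ : IsOpen U₀) (hU : IsOpen U) (hV : IsOpen V)
    (hU₀ne : U₀.Nonempty) (hUne : U.Nonempty) (hVne : V.Nonempty) :
    ∃ W ⊆ U₀, IsOpen W ∧ W.Nonempty ∧ ∃ F : Finset ℕ, ∀ y, ∃ f ∈ F, S^[f] y ∈ V ∧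
      ∀ w ∈ W, T^[f] w ∈ U := by
  obtain ⟨x, hxU₀, hx⟩ := hT.exists_dense_orbit hTc hU₀ hU₀ne
  obtain ⟨F, hF⟩ := isCompact_univ.elim_finite_subcover
    (fun n : {n : ℕ // T^[n] x ∈ U} => S^[n] ⁻¹' V)
    (fun n => hV.preimage (hSc.iterate n)) fun y _ => by
      obtain ⟨n, hn, hy⟩ := hd.exists_iterate_mem hTc hSc hx (hS y) hU hV hUne hVne
      exact mem_iUnion.2 ⟨⟨n, hn⟩, hy⟩
  refine ⟨U₀ ∩ ⋂ n ∈ F, T^[n] ⁻¹' U, inter_subset_left,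
    hU₀.inter (isOpen_biInter_finset fun n _ => hU.preimage (hTc.iterate n)),
    ⟨x, hxU₀, mem_iInter₂.2 fun n _ => n.2⟩, F.map (Embedding.subtype _), fun y => ?_⟩
  obtain ⟨f, hf, hy⟩ := mem_iUnion₂.1 (hF (mem_univ y))
  exact ⟨f, Finset.mem_map_of_mem _ hf, hy, fun w hw => mem_iInter₂.1 hw.2 f hf⟩

end Disjointness

section Words

open scoped Computability

/-- Placing the word `w` at position `n` puts no letter `true` on a position in `A`. -/
def AvoidsAt (A : Set ℕ) (n : ℕ) (w : List Bool) : Prop :=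
  ∀ j, w[j]? = some true → n + j ∉ A

lemma AvoidsAt.append {A : Set ℕ} {n : ℕ} {v w : List Bool} (hv : AvoidsAt A n v)
    (hw : AvoidsAt A (n + v.length) w) : AvoidsAt A n (v ++ w) := by
  intro j hj
  rw [List.getElem?_append] at hj
  split_ifs at hj with h
  · exact hv j hj
  · have := hw _ hj
    rwa [show n + v.length + (j - v.length) = n + j by omega] at this

/-- The complement of `A` contains arbitrarily long intervals with bounded gaps. -/
def ThicklySyndeticCompl (A : Set ℕ) : Prop :=
  ∀ l, ∃ g, ∀ n, ∃ i ≤ g, ∀ j ≤ l, n + i + j ∉ A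

/-- A language of nonempty words of bounded length, which at each position has a word that avoids
`A` there. -/
structure IsAdapted (A : Set ℕ) (G : Language Bool) (R : ℕ) : Prop where
  ne_nil : ∀ g ∈ G, g ≠ []
  length_le : ∀ g ∈ G, g.length ≤ R
  exists_avoidsAt : ∀ n, ∃ g ∈ G, AvoidsAt A n g

lemma append_mem_kstar {G : Language Bool} {v w : List Bool} (hv : v ∈ G∗) (hw : w ∈ G∗) :
    v ++ w ∈ G∗ := by
  have : v ++ w ∈ G∗ * G∗ := Language.append_mem_mul hv hw
  rwa [kstar_mul_kstar] at this

lemma IsAdapted.exists_kstar {A : Set ℕ} {G : Language Bool} {R : ℕ} (hG : IsAdapted A G R)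
    (n d : ℕ) : ∃ w ∈ G∗, AvoidsAt A n w ∧ d ≤ w.length ∧ w.length ≤ d + R := by
  induction d with
  | zero => exact ⟨[], Language.nil_mem_kstar G, by simp [AvoidsAt], by simp, by simp⟩
  | succ d ih =>
    obtain ⟨w, hw, hA, hd, hR⟩ := ih
    rcases hd.eq_or_lt with h | h
    · obtain ⟨g, hg, hgA⟩ := hG.exists_avoidsAt (n + w.length)
      have h1 := List.length_pos_of_ne_nil (hG.ne_nil g hg)
      have h2 := hG.length_le g hg
      refine ⟨w ++ g, append_mem_kstar hw (le_kstar (a := G) hg), hA.append hgA, ?_, ?_⟩ <;>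
        rw [List.length_append] <;> omega
    · exact ⟨w, hw, hA, h, by omega⟩

lemma IsAdapted.exists_next {A : Set ℕ} (hA : ThicklySyndeticCompl A) {G : Language Bool} {R : ℕ}
    (hG : IsAdapted A G R) (L : ℕ) :
    ∃ (u : List Bool) (G' : Language Bool) (R' : ℕ), IsAdapted A G' R' ∧ (∀ g ∈ G', u <:+: g) ∧
      G' ≤ G∗ ∧ u ∈ G∗ ∧ AvoidsAt A 0 u ∧ L ≤ u.length := by
  obtain ⟨u, huG, huA, huL, -⟩ := hG.exists_kstar 0 (L + 1)
  obtain ⟨g, hg⟩ := hA (R + u.length)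
  refine ⟨u, {w | w ∈ G∗ ∧ w ≠ [] ∧ w.length ≤ g + R + u.length ∧ u <:+: w}, g + R + u.length,
    ⟨fun w hw => hw.2.1, fun w hw => hw.2.2.1, fun n => ?_⟩, fun w hw => hw.2.2.2,
    fun w hw => hw.1, huG, huA, by omega⟩
  obtain ⟨i, hi, hfree⟩ := hg n
  obtain ⟨w, hw, hwA, h1, h2⟩ := hG.exists_kstar n i
  refine ⟨w ++ u, ⟨append_mem_kstar hw huG, ?_, ?_, (List.suffix_append w u).isInfix⟩,
    hwA.append fun j hj => ?_⟩
  · exact List.append_ne_nil_of_right_ne_nil w (List.ne_nil_of_length_pos (by omega))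
  · rw [List.length_append]; omega
  · obtain ⟨hju, -⟩ := List.getElem?_eq_some_iff.1 hj
    have := hfree (w.length - i + j) (by omega)
    rwa [show n + i + (w.length - i + j) = n + w.length + j by omega] at this

lemma ThicklySyndeticCompl.exists_isAdapted {A : Set ℕ} (hA : ThicklySyndeticCompl A) :
    ∃ G R, IsAdapted A G R ∧ ∀ g ∈ G, [true] <:+: g := by
  obtain ⟨g, hg⟩ := hA 0
  refine ⟨{w | ∃ i ≤ g, w = List.replicate i false ++ [true]}, g + 1, ⟨?_, ?_, fun n => ?_⟩, ?_⟩
  · rintro _ ⟨i, -, rfl⟩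
    simp
  · rintro _ ⟨i, hi, rfl⟩
    simpa using hi
  · obtain ⟨i, hi, hiA⟩ := hg n
    refine ⟨_, ⟨i, hi, rfl⟩, fun j hj => ?_⟩
    have : j = i := by
      rw [List.getElem?_append] at hj
      grind
    exact this ▸ hiA 0 le_rfl
  · rintro _ ⟨i, -, rfl⟩
    exact (List.suffix_append _ _).isInfix

lemma exists_prefix_drop_flatten {u : List Bool} {R : ℕ} (L : List (List Bool))
    (hL : ∀ g ∈ L, g.length ≤ R ∧ u <:+: g) (n : ℕ) (hn : n + R < L.flatten.length) :
    ∃ i ≤ 2 * R, u <+: L.flatten.drop (n + i) := by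
  have key : ∀ g ∈ L, ∀ t, ∃ i ≤ R, u <+: (g ++ t).drop i := by
    intro g hg t
    obtain ⟨hR, p, s, rfl⟩ := hL g hg
    refine ⟨p.length, by simp at hR; omega, ?_⟩
    simp [List.append_assoc]
  induction L generalizing n with
  | nil => simp at hn
  | cons g L ih =>
    rw [List.flatten_cons, List.length_append] at hn
    have hgR := (hL g List.mem_cons_self).1
    rcases le_or_gt g.length n with h | h
    · obtain ⟨i, hi, hu⟩ := ih (fun g hg => hL g (List.mem_cons_of_mem _ hg)) (n - g.length)
        (by omega) fun g hg => key g (List.mem_cons_of_mem _ hg)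
      refine ⟨i, hi, ?_⟩
      rw [List.flatten_cons, show n + i = g.length + (n - g.length + i) by omega,
        List.drop_length_add_append]
      exact hu
    · rcases Nat.eq_zero_or_pos n with rfl | h0
      · obtain ⟨i, hi, hu⟩ := key g List.mem_cons_self L.flatten
        exact ⟨i, by omega, by simpa using hu⟩
      · cases L with
        | nil => simp at hn; omega
        | cons g' L =>
          obtain ⟨i, hi, hu⟩ := key g' (by simp) L.flatten
          refine ⟨g.length - n + i, by omega, ?_⟩
          rw [List.flatten_cons, show n + (g.length - n + i) = g.length + i by omega,
            List.drop_length_add_append]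
          exact hu

lemma ThicklySyndeticCompl.exists_words {A : Set ℕ} (hA : ThicklySyndeticCompl A) :
    ∃ (u : ℕ → List Bool) (m : ℕ → ℕ), u 0 = [true] ∧
      (∀ k, AvoidsAt A 0 (u (k + 1)) ∧ k ≤ (u (k + 1)).length) ∧
      ∀ j k, j < k → ∀ n, n + m j < (u k).length → ∃ i ≤ 2 * m j, u j <+: (u k).drop (n + i) := by
  let State := {p : List Bool × Language Bool × ℕ //
    IsAdapted A p.2.1 p.2.2 ∧ ∀ g ∈ p.2.1, p.1 <:+: g}
  have hstep : ∀ (L : ℕ) (p : State), ∃ q : State, q.1.2.1 ≤ p.1.2.1∗ ∧ q.1.1 ∈ p.1.2.1∗ ∧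
      AvoidsAt A 0 q.1.1 ∧ L ≤ q.1.1.length := by
    rintro L ⟨⟨u, G, R⟩, hG, -⟩
    obtain ⟨u', G', R', h1, h2, h3⟩ := hG.exists_next hA L
    exact ⟨⟨⟨u', G', R'⟩, h1, h2⟩, h3⟩
  choose f hf1 hf2 hf3 hf4 using hstep
  obtain ⟨G₀, R₀, hG₀, hu₀⟩ := hA.exists_isAdapted
  let s : ℕ → State := fun k => Nat.rec ⟨⟨[true], G₀, R₀⟩, hG₀, hu₀⟩ f k
  have hanti : Antitone fun k => (s k).1.2.1∗ := antitone_nat_of_succ_le fun k => by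
    simpa only [kstar_idem] using kstar_mono (hf1 k (s k))
  refine ⟨fun k => (s k).1.1, fun k => (s k).1.2.2, rfl,
    fun k => ⟨hf3 k (s k), hf4 k (s k)⟩, fun j k hjk n hn => ?_⟩
  obtain ⟨k, rfl⟩ := Nat.exists_eq_add_one_of_ne_zero (Nat.ne_zero_of_lt hjk)
  have hmem : (s (k + 1)).1.1 ∈ (s j).1.2.1∗ := hanti (Nat.le_of_lt_succ hjk) (hf2 k (s k))
  obtain ⟨L, hL, hLG⟩ := Language.mem_kstar.1 hmem
  dsimp only at hn ⊢
  rw [hL] at hn ⊢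
  exact exists_prefix_drop_flatten L
    (fun g hg => ⟨(s j).2.1.length_le g (hLG g hg), (s j).2.2 g (hLG g hg)⟩) n hn

end Words

lemma ThicklySyndeticCompl.exists_sequence {A : Set ℕ} (hA : ThicklySyndeticCompl A) :
    ∃ (M : Set (ℕ → Bool)) (z : ℕ → Bool) (m : ℕ), IsMinimalSubset (fun w n => w (n + 1)) M ∧
      z ∈ M ∧ z m = true ∧ ∀ n ∈ A, z n = false := by
  obtain ⟨u, m, hu0, hu, hocc⟩ := hA.exists_words
  let S : (ℕ → Bool) → ℕ → Bool := fun w n => w (n + 1)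
  have hS : Continuous S := continuous_pi fun n => continuous_apply (n + 1)
  have hSn : ∀ n w i, S^[n] w i = w (n + i) := by
    intro n
    induction n with
    | zero => simp
    | succ n ih =>
      intro w i
      rw [iterate_succ_apply, ih]
      exact congrArg w (by omega)
  have agree : ∀ {f : ℕ → ℕ → Bool} {z : ℕ → Bool}, Tendsto f atTop (𝓝 z) → ∀ n,
      ∀ᶠ k in atTop, ∀ i < n, f k i = z i := fun h n => by
    rw [tendsto_pi_nhds] at h
    refine (Finset.eventually_all (Finset.range n)).2 (fun i _ => ?_) |>.mono
      fun k hk i hi => hk i (Finset.mem_range.2 hi)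
    simpa [nhds_discrete] using h i
  let C : Set (ℕ → Bool) := ⋂ j, ⋂ n, ⋃ i ∈ Finset.range (2 * m j + 1),
    {w | ∀ l b, (u j)[l]? = some b → w (n + i + l) = b}
  have hC : ∀ {w}, w ∈ C ↔ ∀ j n, ∃ i < 2 * m j + 1, ∀ l b, (u j)[l]? = some b →
      w (n + i + l) = b := by
    simp [C]
  have hCcl : IsClosed C := by
    refine isClosed_iInter fun j => isClosed_iInter fun n => isClosed_biUnion_finset fun i _ => ?_
    simp only [ofPred_forall]
    exact isClosed_iInter fun l => isClosed_iInter fun b => isClosed_iInter fun _ =>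
      isClosed_eq (continuous_apply _) continuous_const
  have hCinv : MapsTo S C C := by
    intro w hw
    rw [hC] at hw ⊢
    intro j n
    obtain ⟨i, hi, h⟩ := hw j (n + 1)
    exact ⟨i, hi, fun l b hb => by rw [← h l b hb]; exact congrArg w (by omega)⟩
  have hCne : C.Nonempty := by
    obtain ⟨z, φ, hφ, hz⟩ := CompactSpace.tendsto_subseq fun k n => (u (k + 1)).getD n false
    refine ⟨z, hC.2 fun j n => ?_⟩
    obtain ⟨k, hk, hkj⟩ := ((agree hz (n + 2 * m j + (u j).length)).and
      (hφ.tendsto_atTop.eventually_ge_atTop (j + n + m j + 1))).exists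
    have := (hu (φ k)).2
    obtain ⟨i, hi, v, hv⟩ := hocc j (φ k + 1) (by omega) n (by omega)
    refine ⟨i, by omega, fun l b hb => ?_⟩
    obtain ⟨hl, -⟩ := List.getElem?_eq_some_iff.1 hb
    rw [← hk _ (by omega)]
    have h2 : (u (φ k + 1))[n + i + l]? = some b := by
      rw [← List.getElem?_drop, ← hv, List.getElem?_append_left hl, hb]
    simp [h2]
  obtain ⟨M, hMC, hM⟩ := exists_isMinimalSubset hS hCcl hCne hCinv
  obtain ⟨w, hw⟩ := hM.nonempty
  have hstart : ∀ j, ∃ y ∈ M, ∀ l b, (u j)[l]? = some b → y l = b := by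
    intro j
    obtain ⟨i, -, h⟩ := hC.1 (hMC hw) j 0
    refine ⟨S^[i] w, hM.mapsTo.iterate i hw, fun l b hb => ?_⟩
    rw [hSn, ← h l b hb, zero_add]
  choose y hyM hy using hstart
  obtain ⟨z, φ, hφ, hz⟩ := CompactSpace.tendsto_subseq fun k => y (k + 1)
  have hzM : z ∈ M := hM.isClosed.mem_of_tendsto hz (Eventually.of_forall fun k => hyM _)
  obtain ⟨i, -, hi⟩ := hC.1 (hMC hzM) 0 0
  refine ⟨M, z, i, hM, hzM, by simpa using hi 0 true (by simp [hu0]), fun n hn => ?_⟩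
  obtain ⟨k, hk, hkn⟩ := ((agree hz (n + 1)).and
    (hφ.tendsto_atTop.eventually_gt_atTop n)).exists
  have hlen : n < (u (φ k + 1)).length := hkn.trans_le (hu (φ k)).2
  rw [← hk n n.lt_succ_self]
  have h1 := hy (φ k + 1) n _ (List.getElem?_eq_getElem hlen)
  have h2 := (hu (φ k)).1 n
  rw [List.getElem?_eq_getElem hlen] at h2
  rw [comp_apply, h1, ← Bool.not_eq_true]
  intro ht
  exact h2 (by rw [ht]) (by simpa using hn)

lemma ThicklySyndeticCompl.exists_tds {A : Set ℕ} (hA : ThicklySyndeticCompl A) :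
    ∃ 𝒴 : TDS, IsMinimalSys 𝒴.map ∧ ∃ (y : 𝒴.carrier) (V : Set 𝒴.carrier), IsOpen V ∧
      V.Nonempty ∧ ∀ n ∈ A, 𝒴.map^[n] y ∉ V := by
  obtain ⟨M, z, m, hM, hz, hzm, hzA⟩ := hA.exists_sequence
  have hshift : ∀ n (w : ℕ → Bool), (fun (w : ℕ → Bool) n => w (n + 1))^[n] w 0 = w n := by
    intro n
    induction n with
    | zero => simp
    | succ n ih => intro w; rw [iterate_succ_apply, ih]
  obtain ⟨𝒴, hmin, φ, hφ, rfl, hcomm⟩ := hM.exists_tds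
    (continuous_pi fun n => continuous_apply (n + 1))
  obtain ⟨y, rfl⟩ := hz
  refine ⟨𝒴, hmin, y, (fun v => φ v 0) ⁻¹' {true},
    (isOpen_discrete _).preimage ((continuous_apply 0).comp hφ), ⟨𝒴.map^[m] y, ?_⟩, fun n hn => ?_⟩
  · simp [hcomm, hshift, hzm]
  · simp [hcomm, hshift, hzA n hn]

section MinimalPoints

variable {X : Type*} [MetricSpace X] [CompactSpace X] {T : X → X}

lemma exists_isMinimalSubset_inter_nonempty (hTc : Continuous T) (hT : IsTransitiveSys T)
    (hd : ∀ 𝒴 : TDS, IsMinimalSys 𝒴.map → DisjointSys T 𝒴.map) {U : Set X} (hU : IsOpen U)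
    (hne : U.Nonempty) : ∃ M, IsMinimalSubset T M ∧ (M ∩ U).Nonempty := by
  by_contra! hcon
  obtain ⟨u, hu⟩ := hne
  obtain ⟨K, hK, hKcl, hKU⟩ := exists_mem_nhds_isClosed_subset (hU.mem_nhds hu)
  obtain ⟨x, -, hx⟩ := hT.exists_dense_orbit hTc isOpen_univ ⟨u, mem_univ u⟩
  have hfree : ∀ l z, ∃ i, ∀ j ≤ l, T^[i + j] z ∉ K := by
    intro l z
    obtain ⟨M, hMz, hM⟩ := exists_isMinimalSubset hTc isClosed_closure
      ⟨z, subset_closure (self_mem_orbit T z)⟩ (mapsTo_closure_orbit hTc z)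
    obtain ⟨w, hw⟩ := hM.nonempty
    have hopen : IsOpen (⋂ j ∈ Finset.range (l + 1), T^[j] ⁻¹' Kᶜ) :=
      isOpen_biInter_finset fun j _ => hKcl.isOpen_compl.preimage (hTc.iterate j)
    obtain ⟨_, hm, i, rfl⟩ := mem_closure_iff.1 (hMz hw) _ hopen (mem_iInter₂.2 fun j _ hwK =>
      (hcon M hM).subset ⟨hM.mapsTo.iterate j hw, hKU hwK⟩)
    refine ⟨i, fun j hj => ?_⟩
    rw [add_comm, iterate_add_apply]
    exact mem_iInter₂.1 hm j (Finset.mem_range.2 (Nat.lt_succ_of_le hj))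
  have hA : ThicklySyndeticCompl {n | T^[n] x ∈ K} := by
    intro l
    obtain ⟨F, hF⟩ := isCompact_univ.elim_finite_subcover
      (fun i : ℕ => ⋂ j ∈ Finset.range (l + 1), T^[i + j] ⁻¹' Kᶜ)
      (fun i => isOpen_biInter_finset fun j _ => hKcl.isOpen_compl.preimage (hTc.iterate _))
      fun z _ => by
        obtain ⟨i, hi⟩ := hfree l z
        exact mem_iUnion.2 ⟨i, mem_iInter₂.2 fun j hj =>
          hi j (Nat.le_of_lt_succ (Finset.mem_range.1 hj))⟩
    refine ⟨F.sup id, fun n => ?_⟩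
    obtain ⟨i, hi, hz⟩ := mem_iUnion₂.1 (hF (mem_univ (T^[n] x)))
    refine ⟨i, Finset.le_sup (f := id) hi, fun j hj => ?_⟩
    have := mem_iInter₂.1 hz j (Finset.mem_range.2 (Nat.lt_succ_of_le hj))
    rwa [mem_preimage, ← iterate_add_apply, show i + j + n = n + i + j by omega] at this
  obtain ⟨𝒴, hmin, y, V, hV, hVne, hy⟩ := hA.exists_tds
  obtain ⟨n, hnK, hnV⟩ := (hd 𝒴 hmin).exists_iterate_mem hTc 𝒴.cont hx (hmin y) isOpen_interior hV
    ⟨u, mem_interior_iff_mem_nhds.2 hK⟩ hVne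
  exact hy n (interior_subset (s := K) hnK) hnV

end MinimalPoints

lemma isWeaklyMixingSys_of_disjoint {X : Type} [MetricSpace X] [CompactSpace X] {T : X → X}
    (hTc : Continuous T) (hTs : Surjective T) (hT : IsTransitiveSys T)
    (hd : ∀ 𝒴 : TDS, IsMinimalSys 𝒴.map → DisjointSys T 𝒴.map) : IsWeaklyMixingSys T := by
  have key : ∀ U₁ V₁ U₂ V₂ : Set X, IsOpen U₁ → IsOpen V₁ → IsOpen U₂ → IsOpen V₂ →
      U₁.Nonempty → V₁.Nonempty → U₂.Nonempty → V₂.Nonempty →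
      ∃ n, (U₁ ∩ T^[n] ⁻¹' V₁).Nonempty ∧ (U₂ ∩ T^[n] ⁻¹' V₂).Nonempty := by
    intro U₁ V₁ U₂ V₂ hU₁ hV₁ hU₂ hV₂ hU₁n hV₁n hU₂n hV₂n
    obtain ⟨k, hk⟩ := (hT U₂ V₂ hU₂ hV₂ hU₂n hV₂n).nonempty
    obtain ⟨M, hM, z, hzM, hzU, hzV⟩ := exists_isMinimalSubset_inter_nonempty hTc hT hd
      (hU₂.inter (hV₂.preimage (hTc.iterate k))) hk
    obtain ⟨𝒴, hmin, φ, hφ, rfl, hcomm⟩ := hM.exists_tds hTc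
    obtain ⟨y, rfl⟩ := hzM
    obtain ⟨W, hW, hWo, ⟨w, hw⟩, F, hF⟩ := (hd 𝒴 hmin).exists_open_finset hTc 𝒴.cont hT hmin hU₁
      hV₁ (hV₂.preimage hφ) hU₁n hV₁n ⟨𝒴.map^[k] y, by rwa [mem_preimage, hcomm]⟩
    obtain ⟨f, -, hfy, hfW⟩ := hF y
    exact ⟨f, ⟨w, hW hw, hfW w hw⟩, φ y, hzU, by rwa [mem_preimage, ← hcomm]⟩
  intro U V hU hV hUn hVn
  obtain ⟨⟨a, b⟩, hab⟩ := hUn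
  obtain ⟨⟨c, d⟩, hcd⟩ := hVn
  obtain ⟨U₁, U₂, hU₁, hU₂, ha, hb, hUU⟩ := isOpen_prod_iff.1 hU a b hab
  obtain ⟨V₁, V₂, hV₁, hV₂, hc, hd, hVV⟩ := isOpen_prod_iff.1 hV c d hcd
  refine infinite_of_not_bddAbove fun ⟨N, hN⟩ => ?_
  obtain ⟨n, ⟨x, hxU, hxV⟩, y, hyU, hyV⟩ := key U₁ (T^[N + 1] ⁻¹' V₁) U₂ (T^[N + 1] ⁻¹' V₂) hU₁
    (hV₁.preimage (hTc.iterate _)) hU₂ (hV₂.preimage (hTc.iterate _)) ⟨a, ha⟩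
    (Nonempty.preimage ⟨c, hc⟩ (hTs.iterate _)) ⟨b, hb⟩ (Nonempty.preimage ⟨d, hd⟩ (hTs.iterate _))
  have : N + 1 + n ≤ N := hN ⟨(x, y), hUU ⟨hxU, hyU⟩, hVV (by
    rw [iterate_prodMap_apply, iterate_add_apply T (N + 1), iterate_add_apply T (N + 1)]
    exact ⟨hxV, hyV⟩)⟩
  omega

section WeakMixing

variable {X : Type*} [MetricSpace X] {T : X → X}

lemma IsWeaklyMixingSys.exists_common_open [Nonempty X] (hT : IsWeaklyMixingSys T)
    (hTc : Continuous T) {ι : Type*} (F : Finset ι) {U V : ι → Set X} (hU : ∀ i, IsOpen (U i))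
    (hV : ∀ i, IsOpen (V i)) (hUn : ∀ i, (U i).Nonempty) (hVn : ∀ i, (V i).Nonempty) :
    ∃ A B : Set X, IsOpen A ∧ IsOpen B ∧ A.Nonempty ∧ B.Nonempty ∧
      ∀ n, (A ∩ T^[n] ⁻¹' B).Nonempty → ∀ i ∈ F, (U i ∩ T^[n] ⁻¹' V i).Nonempty := by
  classical
  induction F using Finset.induction_on with
  | empty => exact ⟨univ, univ, isOpen_univ, isOpen_univ, univ_nonempty, univ_nonempty, by simp⟩
  | insert i F _ ih =>
    obtain ⟨A, B, hA, hB, hAn, hBn, h⟩ := ih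
    obtain ⟨n, ⟨a, b⟩, hab, hn⟩ := (hT (A ×ˢ B) (U i ×ˢ V i) (hA.prod hB) ((hU i).prod (hV i))
      (hAn.prod hBn) ((hUn i).prod (hVn i))).nonempty
    rw [mem_preimage, iterate_prodMap_apply] at hn
    refine ⟨A ∩ T^[n] ⁻¹' U i, B ∩ T^[n] ⁻¹' V i, hA.inter ((hU i).preimage (hTc.iterate n)),
      hB.inter ((hV i).preimage (hTc.iterate n)), ⟨a, hab.1, hn.1⟩, ⟨b, hab.2, hn.2⟩, ?_⟩
    rintro m ⟨x, ⟨hxA, hxU⟩, hxB, hxV⟩ j hj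
    rcases Finset.mem_insert.1 hj with rfl | hj
    · refine ⟨T^[n] x, hxU, ?_⟩
      rw [mem_preimage, ← iterate_add_apply, add_comm, iterate_add_apply]
      exact hxV
    · exact h m ⟨x, hxA, hxB⟩ j hj

variable [CompactSpace X]

lemma IsWeaklyMixingSys.dense_proximal [Nonempty X] (hT : IsWeaklyMixingSys T)
    (hTc : Continuous T) (d : X) {ε : ℝ} (hε : 0 < ε) :
    Dense (⋃ n : ℕ, {x | dist (T^[n] x) (T^[n] d) < ε}) := by
  rw [dense_iff_inter_open]
  intro U hU hUn
  obtain ⟨F, hF⟩ := isCompact_univ.elim_finite_subcover (fun c : X => Metric.ball c (ε / 2))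
    (fun c => Metric.isOpen_ball)
    (fun c _ => mem_iUnion.2 ⟨c, Metric.mem_ball_self (half_pos hε)⟩)
  obtain ⟨A, B, hA, hB, hAn, hBn, h⟩ := hT.exists_common_open hTc F (U := fun _ => U)
    (V := fun c => Metric.ball c (ε / 2)) (fun _ => hU) (fun c => Metric.isOpen_ball)
    (fun _ => hUn) (fun c => ⟨c, Metric.mem_ball_self (half_pos hε)⟩)
  obtain ⟨n, ⟨a, b⟩, hab, hn⟩ := (hT (A ×ˢ A) (B ×ˢ B) (hA.prod hA) (hB.prod hB)
    (hAn.prod hAn) (hBn.prod hBn)).nonempty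
  rw [mem_preimage, iterate_prodMap_apply] at hn
  obtain ⟨c, hc, hdc⟩ := mem_iUnion₂.1 (hF (mem_univ (T^[n] d)))
  obtain ⟨x, hxU, hxc⟩ := h n ⟨a, hab.1, hn.1⟩ c hc
  refine ⟨x, hxU, mem_iUnion.2 ⟨n, ?_⟩⟩
  have := dist_triangle_right (T^[n] x) (T^[n] d) c
  rw [mem_preimage, Metric.mem_ball] at hxc
  rw [Metric.mem_ball] at hdc
  rw [mem_ofPred_eq]
  linarith

lemma IsWeaklyMixingSys.exists_proximal [Nonempty X] (hT : IsWeaklyMixingSys T)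
    (hTc : Continuous T) {D : Set X} (hD : D.Countable) :
    ∃ x, ∀ d ∈ D, ∀ ε > 0, ∃ n : ℕ, dist (T^[n] x) (T^[n] d) < ε := by
  have := hD.to_subtype
  have hdense : Dense (⋂ p : D × ℕ, ⋃ n : ℕ,
      {x | dist (T^[n] x) (T^[n] (p.1 : X)) < 1 / ((p.2 : ℝ) + 1)}) :=
    dense_iInter_of_isOpen (fun p => isOpen_iUnion fun n =>
      isOpen_lt ((hTc.iterate n).dist continuous_const) continuous_const)
      fun p => hT.dense_proximal hTc _ Nat.one_div_pos_of_nat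
  obtain ⟨x, hx⟩ := hdense.nonempty
  refine ⟨x, fun d hd ε hε => ?_⟩
  obtain ⟨k, hk⟩ := exists_nat_one_div_lt hε
  obtain ⟨n, hn⟩ := mem_iUnion.1 (mem_iInter.1 hx (⟨d, hd⟩, k))
  exact ⟨n, hn.trans hk⟩

lemma exists_forall_le_dist_iterate_lt (hTc : Continuous T) (N : ℕ) {ε : ℝ} (hε : 0 < ε) :
    ∃ δ > 0, ∀ a b : X, dist a b < δ → ∀ j ≤ N, dist (T^[j] a) (T^[j] b) < ε := by
  induction N with
  | zero => exact ⟨ε, hε, fun a b h j hj => by simpa [Nat.le_zero.1 hj] using h⟩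
  | succ N ih =>
    obtain ⟨δ, hδ, h⟩ := ih
    obtain ⟨δ', hδ', h'⟩ := Metric.uniformContinuous_iff.1
      (CompactSpace.uniformContinuous_of_continuous (hTc.iterate (N + 1))) ε hε
    refine ⟨min δ δ', lt_min hδ hδ', fun a b hab j hj => ?_⟩
    rcases Nat.le_succ_iff.1 hj with hj | rfl
    · exact h a b (hab.trans_le (min_le_left _ _)) j hj
    · exact h' (hab.trans_le (min_le_right _ _))

lemma IsWeaklyMixingSys.disjointSys (hT : IsWeaklyMixingSys T) (hTc : Continuous T)
    (hTs : Surjective T) {D : Set X} (hD : D.Countable) {Y : Type*} [TopologicalSpace Y]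
    {S : Y → Y} (hS : IsMinimalSys S)
    (h : ∀ (y : Y) (V : Set Y), IsOpen V → y ∈ V → ∀ U : Set X, IsOpen U → U.Nonempty →
      ∃ x ∈ D ∩ U, Syndetic {n : ℕ | T^[n] x ∈ U ∧ S^[n] y ∈ V}) : DisjointSys T S := by
  rintro J ⟨hJn, hJcl, hJinv, hJX, -⟩
  have : Nonempty X := ⟨hJn.some.1⟩
  obtain ⟨x, hx⟩ := hT.exists_proximal hTc hD
  obtain ⟨y, hxy⟩ : ∃ y, (x, y) ∈ J := by
    obtain ⟨p, hp, rfl⟩ : x ∈ Prod.fst '' J := hJX ▸ mem_univ x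
    exact ⟨p.2, hp⟩
  have hfiber : ∀ u, (u, y) ∈ J := by
    intro u
    rw [← hJcl.closure_eq, mem_closure_iff]
    intro O hO huO
    obtain ⟨U, V, hU, hV, hu, hy, hUV⟩ := isOpen_prod_iff.1 hO u y huO
    obtain ⟨r, hr, hrU⟩ := Metric.isOpen_iff.1 hU u hu
    obtain ⟨d, ⟨hdD, -⟩, N, hN⟩ := h y V hV hy (Metric.ball u (r / 2)) Metric.isOpen_ball
      ⟨u, Metric.mem_ball_self (half_pos hr)⟩
    obtain ⟨δ, hδ, hclose⟩ := exists_forall_le_dist_iterate_lt hTc N (half_pos hr)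
    obtain ⟨n, hn⟩ := hx d hdD δ hδ
    obtain ⟨j, hj, hjd, hjy⟩ := hN n
    have hlt := hclose _ _ hn j hj
    rw [← iterate_add_apply, ← iterate_add_apply, add_comm j n] at hlt
    refine ⟨(T^[n + j] x, S^[n + j] y), hUV ⟨hrU ?_, hjy⟩, ?_⟩
    · rw [Metric.mem_ball] at hjd ⊢
      linarith [dist_triangle (T^[n + j] x) (T^[n + j] d) u]
    · have hmaps : MapsTo (fun q : X × Y => (T q.1, S q.2)) J J := fun q hq => hJinv q hq
      have := hmaps.iterate (n + j) hxy
      rwa [iterate_prodMap_apply] at this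
  have hcl : IsClosed {v | ∀ u, (u, v) ∈ J} := by
    simp only [ofPred_forall]
    exact isClosed_iInter fun u => hJcl.preimage (Continuous.prodMk_right u)
  have hmaps : MapsTo S {v | ∀ u, (u, v) ∈ J} {v | ∀ u, (u, v) ∈ J} := by
    intro v hv u
    obtain ⟨u', rfl⟩ := hTs u
    exact hJinv _ (hv u')
  exact eq_univ_of_forall fun ⟨u, v⟩ =>
    closure_minimal (orbit_subset_of_mapsTo hmaps hfiber) hcl (hS y v) u

end WeakMixing

theorem stmt_0 {X : Type} [MetricSpace X] [CompactSpace X] (T : X → X)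
    (hTc : Continuous T) (hTs : Function.Surjective T) (hTtr : IsTransitiveSys T) :
    (∀ 𝒴 : TDS, IsMinimalSys 𝒴.map → DisjointSys T 𝒴.map) ↔
      (IsWeaklyMixingSys T ∧ ∃ D : Set X, D.Countable ∧ Dense D ∧
        ∀ 𝒴 : TDS, IsMinimalSys 𝒴.map →
          ∀ (y : 𝒴.carrier) (V : Set 𝒴.carrier), IsOpen V → y ∈ V →
            ∀ U : Set X, IsOpen U → U.Nonempty →
              ∃ x ∈ D ∩ U, Syndetic {n : ℕ | T^[n] x ∈ U ∧ 𝒴.map^[n] y ∈ V}) := by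
  constructor
  · intro hd
    refine ⟨isWeaklyMixingSys_of_disjoint hTc hTs hTtr hd, ?_⟩
    have hdense : Dense {x | ∃ M, IsMinimalSubset T M ∧ x ∈ M} := by
      rw [dense_iff_inter_open]
      intro U hU hUn
      obtain ⟨M, hM, x, hxM, hxU⟩ := exists_isMinimalSubset_inter_nonempty hTc hTtr hd hU hUn
      exact ⟨x, hxU, M, hM, hxM⟩
    obtain ⟨D, hDM, hDc, hDd⟩ := hdense.exists_countable_dense_subset
    refine ⟨D, hDc, hDd, fun 𝒴 hmin y V hV hyV U hU hUn => ?_⟩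
    obtain ⟨W, hWU, hW, hWn, F, hF⟩ := (hd 𝒴 hmin).exists_open_finset hTc 𝒴.cont hTtr hmin hU hU
      hV hUn hUn ⟨y, hyV⟩
    obtain ⟨x, hxW, hxD⟩ := hDd.inter_open_nonempty W hW hWn
    obtain ⟨M, hM, hxM⟩ := hDM hxD
    obtain ⟨N, hN⟩ := hM.syndetic hTc hW ⟨x, hxM, hxW⟩ hxM
    refine ⟨x, ⟨hxD, hWU hxW⟩, N + F.sup id, fun i => ?_⟩
    obtain ⟨j, hj, hjW⟩ := hN i
    obtain ⟨f, hf, hfy, hfW⟩ := hF (𝒴.map^[i + j] y)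
    refine ⟨j + f, add_le_add hj (Finset.le_sup (f := id) hf), ?_⟩
    rw [mem_ofPred_eq, show i + (j + f) = f + (i + j) by omega, iterate_add_apply T f,
      iterate_add_apply _ f]
    exact ⟨hfW _ hjW, hfy⟩
  · rintro ⟨hwm, D, hDc, -, h⟩ 𝒴 hmin
    exact hwm.disjointSys hTc hTs hDc hmin (h 𝒴 hmin)
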